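/- Chord lemma: let γ : [a,b] → ℝ³ be a smooth arc with γ(a) ≠ γ(b), and let w = γ(b) − γ(a). If α = ∠(w, γ'(a)) and β = ∠(w, γ'(b)), then the total curvature of γ is at least α + β. -/

import Mathlib

open Set

lemma unit_angle_eq {V : Type*} [NormedAddCommGroup V] [InnerProductSpace ℝ V] (x y : V)
    (hx : ‖x‖ = 1) (hy : ‖y‖ = 1) :
    InnerProductGeometry.angle x y = 2 * Real.arcsin (‖y - x‖ / 2) := by
  have h0 := InnerProductGeometry.angle_nonneg x y
  have h1 := InnerProductGeometry.angle_le_pi x y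
  have hc : Real.cos (InnerProductGeometry.angle x y) = inner ℝ x y := by
    rw [InnerProductGeometry.cos_angle, hx, hy]; simp
  set θ := InnerProductGeometry.angle x y with hθ
  have hn : ‖y - x‖ ^ 2 = 2 - 2 * Real.cos θ := by
    rw [@norm_sub_sq_real, hx, hy, hc, real_inner_comm]; ring
  have hs : Real.sin (θ / 2) = ‖y - x‖ / 2 := by
    have hs0 : 0 ≤ Real.sin (θ / 2) := Real.sin_nonneg_of_nonneg_of_le_pi (by linarith) (by linarith)
    have h2 : Real.cos θ = 1 - 2 * Real.sin (θ / 2) ^ 2 := by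
      have := Real.cos_two_mul (θ / 2)
      have h3 := Real.sin_sq_add_cos_sq (θ / 2)
      rw [show 2 * (θ / 2) = θ by ring] at this
      linarith
    have h4 : Real.sin (θ / 2) ^ 2 = (‖y - x‖ / 2) ^ 2 := by
      rw [div_pow, hn, h2]; ring
    exact (pow_left_inj₀ hs0 (by positivity) two_ne_zero).1 h4
  rw [← hs, Real.arcsin_sin (by linarith [Real.pi_pos]) (by linarith)]
  ring

lemma angle_le_length {V : Type*} [NormedAddCommGroup V] [InnerProductSpace ℝ V]
    (a b : ℝ) (T T' : ℝ → V) (L : ℝ → ℝ)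
    (hT : ∀ t ∈ Icc a b, HasDerivWithinAt T (T' t) (Icc a b) t)
    (hunit : ∀ t ∈ Icc a b, ‖T t‖ = 1)
    (hL : ∀ t ∈ Icc a b, HasDerivAt L ‖T' t‖ t)
    (s t : ℝ) (hs : a ≤ s) (hst : s ≤ t) (ht : t ≤ b) :
    InnerProductGeometry.angle (T s) (T t) ≤ L t - L s := by
  have hsub : Icc s t ⊆ Icc a b := Icc_subset_Icc hs ht
  have hsm : s ∈ Icc a b := hsub ⟨le_rfl, hst⟩
  have hcT : ContinuousOn T (Icc s t) := fun x hx =>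
    ((hT x (hsub hx)).continuousWithinAt).mono hsub
  have key := @image_le_of_liminf_slope_right_le_deriv_boundary
    (fun z => InnerProductGeometry.angle (T s) (T z)) s t ?_
    (fun z => L z - L s) (fun z => ‖T' z‖) ?_ ?_ ?_ ?_
  · exact key ⟨hst, le_rfl⟩
  · intro x hx
    have hne : ∀ z ∈ Icc a b, T z ≠ 0 := fun z hz h => by
      have := hunit z hz
      rw [h] at this; simp at this
    have := InnerProductGeometry.continuousAt_angle (x := (T s, T x)) (hne s hsm) (hne x (hsub hx))
    exact ContinuousAt.comp_continuousWithinAt (f := fun z => (T s, T z)) this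
      (continuousWithinAt_const.prodMk (hcT x hx))
  · have : T s ≠ 0 := fun h => by
      have := hunit s hsm
      rw [h] at this; simp at this
    simp [InnerProductGeometry.angle_self this]
  · intro x hx
    exact ((hL x (hsub hx)).continuousAt.sub continuousAt_const).continuousWithinAt
  · intro x hx
    exact ((hL x (hsub ⟨hx.1, hx.2.le⟩)).sub_const _).hasDerivWithinAt
  · intro x hx r hr
    apply Filter.Eventually.frequently
    have hxm := hsub ⟨hx.1, hx.2.le⟩
    obtain ⟨r', h1, h2⟩ := exists_between hr
    have hTx : HasDerivWithinAt T (T' x) (Ioi x) x := by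
      apply (hT x hxm).mono_of_mem_nhdsWithin
      exact Filter.mem_of_superset (Ioc_mem_nhdsGT hx.2)
        (fun z hz => hsub ⟨hx.1.trans hz.1.le, hz.2⟩)
    have e1 := hTx.limsup_norm_slope_le h1
    have hA : HasDerivAt (fun z => 2 * Real.arcsin (r' * (z - x) / 2)) r' x := by
      have hin : HasDerivAt (fun z => r' * (z - x) / 2) (r' / 2) x := by
        have := (((hasDerivAt_id x).sub_const x).const_mul r').div_const 2
        simpa using this
      have ha : HasDerivAt Real.arcsin 1 (r' * (x - x) / 2) := by
        have := Real.hasDerivAt_arcsin (x := 0) (by norm_num) (by norm_num)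
        simpa using this
      have := (ha.comp x hin).const_mul 2
      exact this.congr_deriv (by ring)
    have e2 := (hA.hasDerivWithinAt (s := Ioi x)).limsup_slope_le' (by simp) h2
    filter_upwards [e1, e2, Ioc_mem_nhdsGT hx.2] with z hz1 hz2 hz
    have hzp : 0 < z - x := sub_pos.2 hz.1
    refine lt_of_le_of_lt ?_ hz2
    rw [slope_def_field, slope_def_field]
    apply div_le_div_of_nonneg_right _ hzp.le
    have tri := InnerProductGeometry.angle_le_angle_add_angle (T s) (T x) (T z)
    have hzm : z ∈ Icc a b := hsub ⟨hx.1.trans hz.1.le, hz.2⟩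
    rw [unit_angle_eq (T x) (T z) (hunit x hxm) (hunit z hzm)] at tri
    have hb : ‖T z - T x‖ ≤ r' * (z - x) := by
      rw [Real.norm_of_nonneg hzp.le, inv_mul_lt_iff₀ hzp] at hz1
      linarith
    have := Real.monotone_arcsin (show ‖T z - T x‖ / 2 ≤ r' * (z - x) / 2 by linarith)
    simp only [sub_self, mul_zero, zero_div, Real.arcsin_zero]
    linarith

lemma cos_add_cos_pos' (x y : ℝ) (hx : 0 ≤ x) (hy : 0 ≤ y) (h : x + y < Real.pi) :
    0 < Real.cos x + Real.cos y := by
  have : Real.cos (Real.pi - y) < Real.cos x :=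
    Real.cos_lt_cos_of_nonneg_of_le_pi hx (by linarith) (by linarith)
  rw [Real.cos_pi_sub] at this
  linarith

/-- Chord lemma: let `γ : [a,b] → ℝ³` be a smooth unit-speed arc with `γ a ≠ γ b`, and let
`w = γ b - γ a`. If `α = ∠(w, γ' a)` and `β = ∠(w, γ' b)`, then the total curvature
`∫_a^b ‖γ''‖` of `γ` is at least `α + β`. -/
theorem chord_lemma
    (a b : ℝ) (hab : a ≤ b)
    (γ γ' γ'' : ℝ → EuclideanSpace ℝ (Fin 3))
    (hd1 : ∀ t ∈ Icc a b, HasDerivWithinAt γ (γ' t) (Icc a b) t)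
    (hd2 : ∀ t ∈ Icc a b, HasDerivWithinAt γ' (γ'' t) (Icc a b) t)
    (hcont : ContinuousOn γ'' (Icc a b))
    (hunit : ∀ t ∈ Icc a b, ‖γ' t‖ = 1)
    (hne : γ a ≠ γ b) :
    InnerProductGeometry.angle (γ b - γ a) (γ' a) +
      InnerProductGeometry.angle (γ b - γ a) (γ' b) ≤ ∫ s in a..b, ‖γ'' s‖ := by
  have hlt : a < b := lt_of_le_of_ne hab (fun h => hne (by rw [h]))
  set κ : ℝ → ℝ := IccExtend hab ((Icc a b).restrict fun s => ‖γ'' s‖) with hκ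
  have hκc : Continuous κ := (continuousOn_iff_continuous_restrict.1 hcont.norm).Icc_extend'
  have hκe : ∀ t ∈ Icc a b, κ t = ‖γ'' t‖ := fun t ht => by
    rw [hκ, IccExtend_of_mem _ _ ht]; rfl
  have hint : ∫ s in a..b, ‖γ'' s‖ = ∫ s in a..b, κ s := by
    apply intervalIntegral.integral_congr
    intro t ht
    rw [uIcc_of_le hab] at ht
    exact (hκe t ht).symm
  rw [hint]
  set L : ℝ → ℝ := fun t => ∫ s in a..t, κ s with hLdef
  have hLd : ∀ t, HasDerivAt L (κ t) t := fun t => hκc.integral_hasStrictDerivAt a t |>.hasDerivAt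
  have hLa : L a = 0 := by simp [hLdef]
  have hlen := angle_le_length a b γ' γ'' L hd2 hunit (fun t ht => hκe t ht ▸ hLd t)
  change _ ≤ L b
  by_contra! hcon
  set w := γ b - γ a with hw
  have hw0 : w ≠ 0 := sub_ne_zero.2 hne.symm
  set α := InnerProductGeometry.angle w (γ' a) with hα
  set β := InnerProductGeometry.angle w (γ' b) with hβ
  have hAB := hlen a b le_rfl hab le_rfl
  have t1 := InnerProductGeometry.angle_le_angle_add_angle w (γ' a) (γ' b)
  have t2 := InnerProductGeometry.angle_le_angle_add_angle w (γ' b) (γ' a)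
  rw [InnerProductGeometry.angle_comm (γ' b) (γ' a)] at t2
  have hLc : Continuous L := continuous_iff_continuousAt.2 fun t => (hLd t).continuousAt
  obtain ⟨c, hc, hcv⟩ : ∃ c ∈ Icc a b, 2 * L c = L b + α - β := by
    have := intermediate_value_Icc hab (f := fun c => 2 * L c) (by fun_prop)
    exact this ⟨by simp only [hLa]; linarith, by linarith⟩
  have main : ∀ t ∈ Icc a b, InnerProductGeometry.angle (-w) (γ' t) +
      InnerProductGeometry.angle (γ' c) (γ' t) < Real.pi := by
    intro t ht
    rcases le_total t c with h | h
    · have h1 := hlen a t le_rfl ht.1 ht.2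
      have h2 := hlen t c ht.1 h hc.2
      rw [InnerProductGeometry.angle_comm] at h2
      have h3 := InnerProductGeometry.angle_le_angle_add_angle (-w) (γ' a) (γ' t)
      rw [InnerProductGeometry.angle_neg_left w (γ' a)] at h3
      linarith
    · have h1 := hlen t b ht.1 ht.2 le_rfl
      have h2 := hlen c t hc.1 h ht.2
      have h3 := InnerProductGeometry.angle_le_angle_add_angle (-w) (γ' b) (γ' t)
      rw [InnerProductGeometry.angle_neg_left w (γ' b), InnerProductGeometry.angle_comm (γ' b)] at h3
      linarith
  have hwn : 0 < ‖w‖ := norm_pos_iff.2 hw0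
  set u := ‖w‖ • γ' c - w with hu
  have hpos : ∀ t ∈ Icc a b, 0 < inner ℝ u (γ' t) := by
    intro t ht
    have h := cos_add_cos_pos' _ _ (InnerProductGeometry.angle_nonneg _ _)
      (InnerProductGeometry.angle_nonneg _ _) (main t ht)
    have e1 := InnerProductGeometry.cos_angle_mul_norm_mul_norm (-w) (γ' t)
    have e2 := InnerProductGeometry.cos_angle_mul_norm_mul_norm (γ' c) (γ' t)
    rw [norm_neg, hunit t ht, inner_neg_left] at e1
    rw [hunit t ht, hunit c hc] at e2
    rw [hu, inner_sub_left, real_inner_smul_left]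
    have := mul_pos hwn h
    nlinarith
  have hmono : StrictMonoOn (fun t => inner ℝ u (γ t)) (Icc a b) := by
    have hd : ∀ t ∈ Icc a b, HasDerivWithinAt (fun t => inner ℝ u (γ t))
        (inner ℝ u (γ' t)) (Icc a b) t := fun t ht =>
      (innerSL ℝ u).hasFDerivAt.comp_hasDerivWithinAt t (hd1 t ht)
    apply strictMonoOn_of_deriv_pos (convex_Icc a b) (fun t ht => (hd t ht).continuousWithinAt)
    intro t ht
    rw [interior_Icc] at ht
    rw [((hd t ⟨ht.1.le, ht.2.le⟩).hasDerivAt (Icc_mem_nhds ht.1 ht.2)).deriv]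
    exact hpos t ⟨ht.1.le, ht.2.le⟩
  have h1 := hmono ⟨le_rfl, hab⟩ ⟨hab, le_rfl⟩ hlt
  have h2 : 0 < inner ℝ u w := by
    rw [hw, inner_sub_right]
    exact sub_pos.2 h1
  rw [hu, inner_sub_left, real_inner_smul_left, real_inner_self_eq_norm_sq] at h2
  have h3 := real_inner_le_norm (γ' c) w
  rw [hunit c hc] at h3
  nlinarith
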